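/- arXiv:1408.0974 — 2 statements merged into one kernel-verified Lean document; each statement's English description precedes it below -/
import Mathlib

section
/- (Corollary for the gradient method) Let Φ : H → ℝ be convex and differentiable with Lipschitz-continuous gradient, assume S = argmin Φ is nonempty, and let (λ_n) be a positive sequence with ∑ λ_n = +∞ and ∑ λ_n² < +∞. Let (x_n) be generated by the gradient method: x₁ ∈ H and x_{n+1} = x_n − λ_n ∇Φ(x_n) for all n ≥ 1. Then (x_n) converges weakly to a point of S as n → ∞, and lim_{n→∞} Φ(x_n) = min Φ. -/
open Filter Topology
open scoped RealInnerProductSpace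

variable {H : Type*} [NormedAddCommGroup H] [InnerProductSpace ℝ H] [CompleteSpace H]

/-- A set-valued operator `A : H → Set H` is monotone. -/
def MonotoneOp (A : H → Set H) : Prop :=
  ∀ x y x' y', x' ∈ A x → y' ∈ A y → 0 ≤ ⟪x' - y', x - y⟫

/-- A set-valued operator is maximal monotone: it is monotone and its graph is not
properly contained in the graph of any other monotone operator. -/
def MaxMonotoneOp (A : H → Set H) : Prop :=
  MonotoneOp A ∧ ∀ B : H → Set H, MonotoneOp B → (∀ x, A x ⊆ B x) → B = A

/-- The (outward) normal cone to a set `C` at `x`: empty when `x ∉ C`. -/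
def nCone (C : Set H) (x : H) : Set H :=
  {p | x ∈ C ∧ ∀ c ∈ C, ⟪p, c - x⟫ ≤ 0}

/-- Subdifferential of an extended-real-valued function. -/
def ESubdiff (F : H → EReal) (x : H) : Set H :=
  {p | ∀ y, F x + ((⟪p, y - x⟫ : ℝ) : EReal) ≤ F y}

/-- Fenchel conjugate of an extended-real-valued function. -/
noncomputable def fenchelConj (F : H → EReal) (p : H) : EReal :=
  ⨆ y, (((⟪y, p⟫ : ℝ) : EReal) - F y)

/-- Support function of a set. -/
noncomputable def suppFun (C : Set H) (p : H) : EReal :=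
  ⨆ c : C, ((⟪p, (c : H)⟫ : ℝ) : EReal)

/-- `F : H → EReal` is proper (not identically `+∞`, never `−∞`),
lower-semicontinuous and convex. -/
def ProperLscConvexE (F : H → EReal) : Prop :=
  (∃ x, F x ≠ ⊤) ∧ (∀ x, F x ≠ ⊥) ∧ LowerSemicontinuous F ∧
    ∀ x y (t : ℝ), 0 ≤ t → t ≤ 1 →
      F (t • x + (1 - t) • y) ≤ ((t : ℝ) : EReal) * F x + (((1 - t : ℝ)) : EReal) * F y

/-- Weak convergence of a sequence in a Hilbert space. -/
def WeakConv (x : ℕ → H) (p : H) : Prop :=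
  ∀ y : H, Tendsto (fun n => ⟪x n, y⟫) atTop (𝓝 ⟪p, y⟫)

/-- A weak cluster point: weak limit of some subsequence. -/
def WeakClusterPt (x : ℕ → H) (p : H) : Prop :=
  ∃ φ : ℕ → ℕ, StrictMono φ ∧ WeakConv (x ∘ φ) p

/-- Boundedly inf-compact function: intersections of balls and sublevel sets are
relatively compact. -/
def BddInfCompact (F : H → EReal) : Prop :=
  ∀ R M : ℝ, 0 ≤ R → IsCompact (closure {p : H | ‖p‖ ≤ R ∧ F p ≤ (M : EReal)})

/-- The data of the (SFBP) algorithm together with hypotheses (H₀). -/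
structure SFBP (H : Type*) [NormedAddCommGroup H] [InnerProductSpace ℝ H]
    [CompleteSpace H] where
  /-- the maximal monotone operator -/
  A : H → Set H
  /-- the smooth potential -/
  Φ : H → ℝ
  /-- its gradient -/
  Φ' : H → H
  /-- the smooth penalization potential -/
  Ψ₁ : H → ℝ
  /-- its gradient -/
  Ψ₁' : H → H
  /-- the nonsmooth penalization potential -/
  Ψ₂ : H → EReal
  /-- the constraint set -/
  C : Set H
  /-- the step sizes -/
  lam : ℕ → ℝ
  /-- the penalization parameters -/
  beta : ℕ → ℝ
  /-- Lipschitz constant of ∇Φ -/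
  LΦ : ℝ
  /-- Lipschitz constant of ∇Ψ₁ -/
  LΨ₁ : ℝ
  /-- the sequence generated by the algorithm -/
  x : ℕ → H
  convΦ : ConvexOn ℝ Set.univ Φ
  gradΦ : ∀ p, HasGradientAt Φ (Φ' p) p
  lipΦ : ∀ p q, ‖Φ' p - Φ' q‖ ≤ LΦ * ‖p - q‖
  convΨ₁ : ConvexOn ℝ Set.univ Ψ₁
  gradΨ₁ : ∀ p, HasGradientAt Ψ₁ (Ψ₁' p) p
  lipΨ₁ : ∀ p q, ‖Ψ₁' p - Ψ₁' q‖ ≤ LΨ₁ * ‖p - q‖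
  properΨ₂ : ProperLscConvexE Ψ₂
  Ψ₁nonneg : ∀ p, 0 ≤ Ψ₁ p
  Ψ₂nonneg : ∀ p, (0 : EReal) ≤ Ψ₂ p
  minΨ₁ : ∃ p, Ψ₁ p = 0
  minΨ₂ : ∃ p, Ψ₂ p = 0
  Cdef : C = {p | ∀ q, Ψ₁ p ≤ Ψ₁ q} ∩ {p | ∀ q, Ψ₂ p ≤ Ψ₂ q}
  Cne : C.Nonempty
  maxmonA : MaxMonotoneOp A
  maxmonT : MaxMonotoneOp
    (fun p => {w | ∃ za ∈ A p, ∃ v ∈ nCone C p, w = za + Φ' p + v})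
  Sne : ∃ p, ∃ za ∈ A p, ∃ v ∈ nCone C p, za + Φ' p + v = 0
  lamPos : ∀ n, 0 < lam n
  betaPos : ∀ n, 0 < beta n
  lamDiv : Tendsto (fun N => ∑ k ∈ Finset.range N, lam k) atTop atTop
  sumSq : Summable fun n => LΦ * lam n ^ 2
  limsupCond : ∃ γ : ℝ, γ < 2 ∧ ∀ᶠ n in atTop, LΨ₁ * (lam n * beta n) ≤ γ
  keyCond : ∀ z : H, (∃ u, z ∈ nCone C u) →
    ∃ M : ℝ, ∀ N : ℕ, ∑ n ∈ Finset.range N,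
      (((lam n * beta n : ℝ)) : EReal) *
        (fenchelConj (fun q => ((Ψ₁ q : ℝ) : EReal) + Ψ₂ q) ((beta n)⁻¹ • z)
          - suppFun C ((beta n)⁻¹ • z)) ≤ (M : EReal)
  algo : ∀ n, ∃ a ∈ A (x (n + 1)), ∃ w ∈ ESubdiff Ψ₂ (x (n + 1)),
    x n - x (n + 1) = lam n • (Φ' (x n) + beta n • Ψ₁' (x n) + a + beta n • w)

/-- The solution set `S = (A + ∇Φ + N_C)⁻¹(0)`. -/
def SFBP.S (d : SFBP H) : Set H :=
  {p | ∃ za ∈ d.A p, ∃ v ∈ nCone d.C p, za + d.Φ' p + v = 0}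

/-- Gradient inequality for convex differentiable functions. -/
theorem gm_grad_ineq (Φ : H → ℝ) (Φ' : H → H)
    (hconv : ConvexOn ℝ Set.univ Φ) (hgrad : ∀ p, HasGradientAt Φ (Φ' p) p) (a b : H) :
    Φ a + ⟪Φ' a, b - a⟫ ≤ Φ b := by
  have h1 : ConvexOn ℝ Set.univ (fun t : ℝ => Φ (AffineMap.lineMap a b t)) := by
    have := hconv.comp_affineMap (AffineMap.lineMap (k := ℝ) a b)
    simpa [Function.comp_def] using this
  have h2 : HasDerivAt (fun t : ℝ => Φ (AffineMap.lineMap a b t)) ⟪Φ' a, b - a⟫ 0 := by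
    have hl : HasDerivAt (fun t : ℝ => AffineMap.lineMap (k := ℝ) a b t) (b - a) 0 :=
      AffineMap.hasDerivAt_lineMap
    have hf : HasFDerivAt Φ (InnerProductSpace.toDual ℝ H (Φ' a))
        (AffineMap.lineMap (k := ℝ) a b (0 : ℝ)) := by
      simpa using (hgrad a).hasFDerivAt
    exact hf.comp_hasDerivAt (0 : ℝ) hl
  have h3 := h1.le_slope_of_hasDerivAt (Set.mem_univ 0) (Set.mem_univ 1) one_pos h2
  simp [slope_def_field] at h3
  linarith

/-- Weak compactness of bounded sequences along ultrafilters. -/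
theorem gm_weak_compact (x : ℕ → H) (R : ℝ) (hR : ∀ n, ‖x n‖ ≤ R) (U : Ultrafilter ℕ) :
    ∃ p : H, ∀ y, Tendsto (fun n => ⟪x n, y⟫) U (𝓝 ⟪p, y⟫) := by
  have hK := WeakDual.isCompact_closedBall (𝕜 := ℝ) (E := H) 0 R
  let f : ℕ → WeakDual ℝ H := fun n => StrongDual.toWeakDual (InnerProductSpace.toDual ℝ H (x n))
  have hf : ∀ n, f n ∈ WeakDual.toStrongDual ⁻¹' Metric.closedBall (0 : StrongDual ℝ H) R := by
    intro n
    have : ‖InnerProductSpace.toDual ℝ H (x n)‖ ≤ R := by simpa using hR n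
    exact mem_closedBall_zero_iff.2 this
  obtain ⟨g, -, hg⟩ := hK.ultrafilter_le_nhds (U.map f)
    (by
      rw [Ultrafilter.coe_map, le_principal_iff]
      exact Filter.mem_map.2 (Filter.Eventually.of_forall hf))
  refine ⟨(InnerProductSpace.toDual ℝ H).symm (WeakDual.toStrongDual g), fun y => ?_⟩
  have h1 : Tendsto f U (𝓝 g) := hg
  have h2 := ((WeakDual.eval_continuous (𝕜 := ℝ) y).tendsto g).comp h1
  rw [InnerProductSpace.toDual_symm_apply]
  exact h2

/-- Version with small steps from the start. -/
theorem gm_small (Φ : H → ℝ) (Φ' : H → H) (L : ℝ)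
    (hconv : ConvexOn ℝ Set.univ Φ) (hgrad : ∀ p, HasGradientAt Φ (Φ' p) p)
    (hlip : ∀ p q, ‖Φ' p - Φ' q‖ ≤ L * ‖p - q‖)
    (hSne : {p : H | ∀ q, Φ p ≤ Φ q}.Nonempty)
    (lam : ℕ → ℝ) (hlam : ∀ n, 0 < lam n)
    (hdiv : Filter.Tendsto (fun N => ∑ k ∈ Finset.range N, lam k) Filter.atTop Filter.atTop)
    (hsmall : ∀ n, L * lam n ≤ 1 / 2)
    (x : ℕ → H) (halgo : ∀ n, x (n + 1) = x n - lam n • Φ' (x n)) :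
    ∃ p, (∀ q, Φ p ≤ Φ q) ∧ WeakConv x p ∧
      Filter.Tendsto (fun n => Φ (x n)) Filter.atTop (𝓝 (Φ p)) := by
  have hG := gm_grad_ineq Φ Φ' hconv hgrad
  obtain ⟨z₀, hz₀⟩ := hSne
  have hz₀ : ∀ q, Φ z₀ ≤ Φ q := hz₀
  -- descent
  have hdesc : ∀ n, lam n * ‖Φ' (x n)‖ ^ 2 ≤ 2 * (Φ (x n) - Φ (x (n + 1))) := by
    intro n
    have h1 := hG (x (n + 1)) (x n)
    have h2 : x n - x (n + 1) = lam n • Φ' (x n) := by rw [halgo]; abel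
    have h3 : ‖Φ' (x n) - Φ' (x (n + 1))‖ ≤ 1 / 2 * ‖Φ' (x n)‖ := by
      have := hlip (x n) (x (n + 1))
      rw [h2, norm_smul, Real.norm_of_nonneg (hlam n).le, ← mul_assoc] at this
      exact this.trans (mul_le_mul_of_nonneg_right (hsmall n) (norm_nonneg _))
    have h4 : ⟪Φ' (x n) - Φ' (x (n + 1)), Φ' (x n)⟫ ≤ 1 / 2 * ‖Φ' (x n)‖ * ‖Φ' (x n)‖ :=
      (real_inner_le_norm _ _).trans (mul_le_mul_of_nonneg_right h3 (norm_nonneg _))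
    rw [inner_sub_left, real_inner_self_eq_norm_sq] at h4
    rw [h2, inner_smul_right] at h1
    have h5 : 1 / 2 * ‖Φ' (x n)‖ ^ 2 ≤ ⟪Φ' (x (n + 1)), Φ' (x n)⟫ := by nlinarith
    have := mul_le_mul_of_nonneg_left h5 (hlam n).le
    linarith
  have hmono : Antitone (fun n => Φ (x n)) := antitone_nat_of_succ_le fun n => by
    have := hdesc n
    have := mul_nonneg (hlam n).le (sq_nonneg ‖Φ' (x n)‖)
    linarith
  -- Fejer inequality
  have hfej : ∀ z, ∀ n, ‖x (n + 1) - z‖ ^ 2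
      ≤ ‖x n - z‖ ^ 2 - 2 * (lam n * (Φ (x (n + 1)) - Φ z)) := by
    intro z n
    have h1 := hG (x n) z
    have h2 : x (n + 1) - z = (x n - z) - lam n • Φ' (x n) := by rw [halgo]; abel
    have h3 : z - x n = -(x n - z) := by abel
    rw [h2, norm_sub_sq_real, inner_smul_right, norm_smul, Real.norm_of_nonneg (hlam n).le,
      real_inner_comm]
    rw [h3, inner_neg_right] at h1
    have h4 := mul_le_mul_of_nonneg_left (hdesc n) (hlam n).le
    have h5 := mul_le_mul_of_nonneg_left h1 (hlam n).le
    nlinarith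
  have hanti : ∀ z, (∀ q, Φ z ≤ Φ q) → Antitone (fun n => ‖x n - z‖ ^ 2) := fun z hz =>
    antitone_nat_of_succ_le fun n => by
      have := hfej z n
      have := mul_nonneg (hlam n).le (sub_nonneg.2 (hz (x (n + 1))))
      linarith
  have hconvg : ∀ z, (∀ q, Φ z ≤ Φ q) → ∃ l, Tendsto (fun n => ‖x n - z‖ ^ 2) atTop (𝓝 l) :=
    fun z hz => ⟨_, tendsto_atTop_ciInf (hanti z hz)
      ⟨0, by rintro _ ⟨n, rfl⟩; positivity⟩⟩
  -- values converge
  have hsumb : ∀ N, 2 * ∑ k ∈ Finset.range N, lam k * (Φ (x (k + 1)) - Φ z₀)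
      ≤ ‖x 0 - z₀‖ ^ 2 - ‖x N - z₀‖ ^ 2 := by
    intro N
    induction N with
    | zero => simp
    | succ N ih => rw [Finset.sum_range_succ]; have := hfej z₀ N; linarith
  have hval : Tendsto (fun n => Φ (x n)) atTop (𝓝 (Φ z₀)) := by
    have hbdd : BddBelow (Set.range fun n => Φ (x n)) := ⟨Φ z₀, by rintro _ ⟨n, rfl⟩; exact hz₀ _⟩
    have ht := tendsto_atTop_ciInf hmono hbdd
    set l := ⨅ n, Φ (x n) with hl
    have hle : ∀ n, l ≤ Φ (x n) := fun n => ciInf_le hbdd n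
    have hge : Φ z₀ ≤ l := le_ciInf fun n => hz₀ _
    have : l = Φ z₀ := by
      by_contra hne
      have hpos : 0 < l - Φ z₀ := sub_pos.2 (lt_of_le_of_ne hge (Ne.symm hne))
      obtain ⟨N, hN⟩ := (hdiv.eventually_gt_atTop (‖x 0 - z₀‖ ^ 2 / (l - Φ z₀))).exists
      rw [div_lt_iff₀ hpos] at hN
      have h1 : (∑ k ∈ Finset.range N, lam k) * (l - Φ z₀)
          ≤ ∑ k ∈ Finset.range N, lam k * (Φ (x (k + 1)) - Φ z₀) := by
        rw [Finset.sum_mul]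
        refine Finset.sum_le_sum fun k _ => mul_le_mul_of_nonneg_left ?_ (hlam k).le
        have := hle (k + 1)
        linarith
      have h2 := hsumb N
      have h3 := sq_nonneg ‖x N - z₀‖
      have h4 := sq_nonneg ‖x 0 - z₀‖
      linarith
    rwa [this] at ht
  -- boundedness
  have hbound : ∀ n, ‖x n‖ ≤ ‖x 0 - z₀‖ + ‖z₀‖ := by
    intro n
    have h1 : ‖x n - z₀‖ ≤ ‖x 0 - z₀‖ :=
      le_of_sq_le_sq (hanti z₀ hz₀ (Nat.zero_le n)) (norm_nonneg _)
    have h2 := norm_add_le (x n - z₀) z₀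
    rw [sub_add_cancel] at h2
    linarith
  -- cluster points along ultrafilters are minimizers
  have hcl : ∀ U : Ultrafilter ℕ, (U : Filter ℕ) ≤ atTop → ∃ p : H, (∀ q, Φ p ≤ Φ q) ∧
      ∀ y, Tendsto (fun n => ⟪x n, y⟫) U (𝓝 ⟪p, y⟫) := by
    intro U hU
    obtain ⟨p, hp⟩ := gm_weak_compact x _ hbound U
    refine ⟨p, fun q => le_trans ?_ (hz₀ q), hp⟩
    have h1 : Tendsto (fun n => Φ p + (⟪x n, Φ' p⟫ - ⟪p, Φ' p⟫)) U
        (𝓝 (Φ p + (⟪p, Φ' p⟫ - ⟪p, Φ' p⟫))) := ((hp _).sub_const _).const_add _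
    rw [sub_self, add_zero] at h1
    refine le_of_tendsto_of_tendsto' h1 (hval.mono_left hU) fun n => ?_
    have := hG p (x n)
    rwa [real_inner_comm, inner_sub_left] at this
  -- uniqueness
  have huniq : ∀ (U V : Ultrafilter ℕ) (p q : H), (U : Filter ℕ) ≤ atTop →
      (V : Filter ℕ) ≤ atTop → (∀ r, Φ p ≤ Φ r) → (∀ r, Φ q ≤ Φ r) →
      (∀ y, Tendsto (fun n => ⟪x n, y⟫) U (𝓝 ⟪p, y⟫)) →
      (∀ y, Tendsto (fun n => ⟪x n, y⟫) V (𝓝 ⟪q, y⟫)) → p = q := by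
    intro U V p q hU hV hp hq hpU hqV
    obtain ⟨a, ha⟩ := hconvg p hp
    obtain ⟨b, hb⟩ := hconvg q hq
    have h1 : Tendsto (fun n => ⟪x n, p - q⟫) atTop
        (𝓝 ((b - a + (‖p‖ ^ 2 - ‖q‖ ^ 2)) / 2)) := by
      refine (((hb.sub ha).add_const _).div_const 2).congr fun n => ?_
      rw [norm_sub_sq_real, norm_sub_sq_real, inner_sub_right]
      ring
    have e1 := tendsto_nhds_unique (hpU (p - q)) (h1.mono_left hU)
    have e2 := tendsto_nhds_unique (hqV (p - q)) (h1.mono_left hV)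
    have e3 : ⟪p - q, p - q⟫ = (0 : ℝ) := by rw [inner_sub_left, e1, e2, sub_self]
    exact sub_eq_zero.1 (inner_self_eq_zero.1 e3)
  obtain ⟨p, hp, hpU⟩ := hcl (Ultrafilter.of atTop) (Ultrafilter.of_le _)
  refine ⟨p, hp, ?_, ?_⟩
  · intro y
    rw [tendsto_iff_ultrafilter]
    intro V hV
    obtain ⟨q, hq, hqV⟩ := hcl V hV
    rw [huniq _ V p q (Ultrafilter.of_le _) hV hp hq hpU hqV]
    exact hqV y
  · rwa [le_antisymm (hp z₀) (hz₀ p)]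

/-- **Corollary (gradient method).** -/
theorem gradient_method_weak (Φ : H → ℝ) (Φ' : H → H) (LΦ : ℝ)
    (hconv : ConvexOn ℝ Set.univ Φ) (hgrad : ∀ p, HasGradientAt Φ (Φ' p) p)
    (hlip : ∀ p q, ‖Φ' p - Φ' q‖ ≤ LΦ * ‖p - q‖)
    (hSne : {p : H | ∀ q, Φ p ≤ Φ q}.Nonempty)
    (lam : ℕ → ℝ) (hlam : ∀ n, 0 < lam n)
    (hdiv : Filter.Tendsto (fun N => ∑ k ∈ Finset.range N, lam k) Filter.atTop Filter.atTop)
    (hsum : Summable fun n => lam n ^ 2)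
    (x : ℕ → H) (halgo : ∀ n, x (n + 1) = x n - lam n • Φ' (x n)) :
    ∃ p, (∀ q, Φ p ≤ Φ q) ∧ WeakConv x p ∧
      Filter.Tendsto (fun n => Φ (x n)) Filter.atTop (𝓝 (Φ p)) := by
  have h0 : Tendsto lam atTop (𝓝 0) := by
    have h := hsum.tendsto_atTop_zero.sqrt
    simpa [Real.sqrt_sq (hlam _).le] using h
  have h1 : Tendsto (fun n => LΦ * lam n) atTop (𝓝 0) := by simpa using h0.const_mul LΦ
  obtain ⟨N, hN⟩ := eventually_atTop.1 (h1.eventually (ge_mem_nhds (by norm_num : (0 : ℝ) < 1 / 2)))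
  have hdiv' : Tendsto (fun M => ∑ k ∈ Finset.range M, lam (k + N)) atTop atTop := by
    have h2 := tendsto_atTop_add_const_right atTop (-∑ k ∈ Finset.range N, lam k)
      ((tendsto_add_atTop_iff_nat N).2 hdiv)
    refine h2.congr fun M => ?_
    rw [add_comm M N, Finset.sum_range_add]
    simp [add_comm]
  obtain ⟨p, hp, hw, hv⟩ := gm_small Φ Φ' LΦ hconv hgrad hlip hSne (fun n => lam (n + N))
    (fun n => hlam _) hdiv' (fun n => hN _ (Nat.le_add_left _ _)) (fun n => x (n + N))
    (fun n => by
      have := halgo (n + N)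
      rwa [show n + N + 1 = n + 1 + N by omega] at this)
  exact ⟨p, hp, fun y => (tendsto_add_atTop_iff_nat N).1 (hw y),
    (tendsto_add_atTop_iff_nat (f := fun n => Φ (x n)) N).1 hv⟩
end

section
/- (Claim 5.9) Let Ψ₁ : H → ℝ be convex and differentiable with ∇Ψ₁ Lipschitz of constant L > 0, with min Ψ₁ = 0, and let u ∈ argmin Ψ₁. Then for all η, θ > 0, all λ, β > 0 and all x, x' ∈ H: 2λβ⟨∇Ψ₁(x), x' − u⟩ ≥ [2/((1+η)L) − ((1+θ)/(1+η))λβ]·λβ‖∇Ψ₁(x)‖² + (2η/(1+η))λβΨ₁(x') − [1/((1+θ)(1+η)) + (ηL/(1+η))λβ]‖x' − x‖². -/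
open Filter Topology
open scoped RealInnerProductSpace

variable {H : Type*} [NormedAddCommGroup H] [InnerProductSpace ℝ H] [CompleteSpace H]

lemma aux_hasDerivAt {Ψ : H → ℝ} {G : H → H} (hg : ∀ p, HasGradientAt Ψ (G p) p) (x y : H)
    (t : ℝ) : HasDerivAt (fun s : ℝ => Ψ (x + s • y)) ⟪G (x + t • y), y⟫ t := by
  have h1 : HasDerivAt (fun s : ℝ => x + s • y) y t := by
    simpa using ((hasDerivAt_id t).smul_const y).const_add x
  have h2 := (hg (x + t • y)).hasFDerivAt.comp_hasDerivAt t h1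
  rw [InnerProductSpace.toDual_apply_apply] at h2
  exact h2

lemma aux_descent {Ψ : H → ℝ} {G : H → H} {L : ℝ} (hg : ∀ p, HasGradientAt Ψ (G p) p)
    (hlip : ∀ p q, ‖G p - G q‖ ≤ L * ‖p - q‖) (x y : H) :
    Ψ (x + y) ≤ Ψ x + ⟪G x, y⟫ + L / 2 * ‖y‖ ^ 2 := by
  have hd : ∀ t : ℝ, HasDerivAt
      (fun s : ℝ => Ψ (x + s • y) - s * ⟪G x, y⟫ - s ^ 2 * (L / 2 * ‖y‖ ^ 2))
      (⟪G (x + t • y), y⟫ - ⟪G x, y⟫ - 2 * t * (L / 2 * ‖y‖ ^ 2)) t := by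
    intro t
    have h1 := aux_hasDerivAt hg x y t
    have h2 : HasDerivAt (fun s : ℝ => s * ⟪G x, y⟫) ⟪G x, y⟫ t := by
      simpa using (hasDerivAt_id t).mul_const ⟪G x, y⟫
    have h3 : HasDerivAt (fun s : ℝ => s ^ 2 * (L / 2 * ‖y‖ ^ 2))
        (2 * t * (L / 2 * ‖y‖ ^ 2)) t := by
      simpa using (hasDerivAt_pow 2 t).mul_const (L / 2 * ‖y‖ ^ 2)
    exact (h1.sub h2).sub h3
  have hanti : AntitoneOn
      (fun s : ℝ => Ψ (x + s • y) - s * ⟪G x, y⟫ - s ^ 2 * (L / 2 * ‖y‖ ^ 2)) (Set.Ici 0) := by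
    apply antitoneOn_of_deriv_nonpos (convex_Ici 0)
    · exact fun t _ => (hd t).continuousAt.continuousWithinAt
    · exact fun t _ => (hd t).differentiableAt.differentiableWithinAt
    · intro t ht
      rw [interior_Ici] at ht
      have ht0 : 0 < t := ht
      rw [(hd t).deriv, ← inner_sub_left]
      have h1 := real_inner_le_norm (G (x + t • y) - G x) y
      have h2 := hlip (x + t • y) x
      rw [add_sub_cancel_left, norm_smul, Real.norm_eq_abs, abs_of_pos ht0] at h2
      have h3 := mul_le_mul_of_nonneg_right h2 (norm_nonneg y)
      nlinarith
  have := hanti (Set.mem_Ici.2 le_rfl) (Set.mem_Ici.2 zero_le_one) zero_le_one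
  simp at this
  linarith

lemma aux_convex {Ψ : H → ℝ} {G : H → H} (hg : ∀ p, HasGradientAt Ψ (G p) p)
    (hconv : ConvexOn ℝ Set.univ Ψ) (x y : H) :
    Ψ x + ⟪G x, y⟫ ≤ Ψ (x + y) := by
  have hc : ConvexOn ℝ Set.univ (fun s : ℝ => Ψ (x + s • y)) := by
    refine ⟨convex_univ, fun s _ t _ a b ha hb hab => ?_⟩
    have h := hconv.2 (Set.mem_univ (x + s • y)) (Set.mem_univ (x + t • y)) ha hb hab
    have e : x + (a • s + b • t) • y = a • (x + s • y) + b • (x + t • y) := by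
      have : x = (a + b) • x := by rw [hab, one_smul]
      nth_rewrite 1 [this]
      simp only [smul_eq_mul]
      module
    simpa only [e] using h
  have hd := aux_hasDerivAt hg x y 0
  have := hc.le_slope_of_hasDerivAt (Set.mem_univ 0) (Set.mem_univ 1) zero_lt_one hd
  simp [slope_def_field] at this
  linarith

/-- **Claim 5.9.** -/
theorem claim_psi_estimate (Ψ₁ : H → ℝ) (Ψ₁' : H → H) (L : ℝ) (hL : 0 < L)
    (hconv : ConvexOn ℝ Set.univ Ψ₁) (hgrad : ∀ p, HasGradientAt Ψ₁ (Ψ₁' p) p)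
    (hlip : ∀ p q, ‖Ψ₁' p - Ψ₁' q‖ ≤ L * ‖p - q‖)
    (hnonneg : ∀ p, 0 ≤ Ψ₁ p)
    (u : H) (hu : ∀ q, Ψ₁ u ≤ Ψ₁ q) (hu0 : Ψ₁ u = 0)
    (η θ lam beta : ℝ) (hη : 0 < η) (hθ : 0 < θ) (hlam : 0 < lam) (hbeta : 0 < beta)
    (x x' : H) :
    (2 / ((1 + η) * L) - (1 + θ) / (1 + η) * (lam * beta)) * (lam * beta) * ‖Ψ₁' x‖ ^ 2
        + 2 * η / (1 + η) * (lam * beta) * Ψ₁ x'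
        - (1 / ((1 + θ) * (1 + η)) + η * L / (1 + η) * (lam * beta)) * ‖x' - x‖ ^ 2
      ≤ 2 * (lam * beta) * ⟪Ψ₁' x, x' - u⟫ := by
  have hGu : Ψ₁' u = 0 := by
    have hm : IsLocalMin Ψ₁ u := Filter.Eventually.of_forall hu
    have := hm.hasFDerivAt_eq_zero (hgrad u).hasFDerivAt
    simpa using this
  set g := Ψ₁' x with hgdef
  have hgg : ⟪g, g⟫ = ‖g‖ ^ 2 := real_inner_self_eq_norm_sq g
  -- first-order convexity inequality at `x`, tested at `u`
  have c1 := aux_convex hgrad hconv x (u - x)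
  rw [add_sub_cancel, hu0, ← hgdef] at c1
  have c2 := aux_convex hgrad hconv x (u + L⁻¹ • g - x)
  rw [add_sub_cancel, ← hgdef, show u + L⁻¹ • g - x = (u - x) + L⁻¹ • g by abel,
    inner_add_right, inner_smul_right, hgg] at c2
  have d1 := aux_descent hgrad hlip u (L⁻¹ • g)
  rw [hGu, inner_zero_left, hu0, norm_smul, Real.norm_eq_abs, abs_of_pos (inv_pos.2 hL)] at d1
  have d2 := aux_descent hgrad hlip x (-(L⁻¹ • g))
  rw [← hgdef, norm_neg, inner_neg_right, inner_smul_right, hgg, norm_smul, Real.norm_eq_abs,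
    abs_of_pos (inv_pos.2 hL)] at d2
  have n2 := hnonneg (x + -(L⁻¹ • g))
  have d3 := aux_descent hgrad hlip x (x' - x)
  rw [add_sub_cancel, ← hgdef] at d3
  have eL : L / 2 * (L⁻¹ * ‖g‖) ^ 2 = L⁻¹ * ‖g‖ ^ 2 / 2 := by field_simp
  rw [eL] at d1 d2
  have eu : ⟪g, x' - u⟫ = ⟪g, x' - x⟫ - ⟪g, u - x⟫ := by
    rw [← inner_sub_right]; congr 1; abel
  have coco : ⟪g, u - x⟫ ≤ -(L⁻¹ * ‖g‖ ^ 2) := by linarith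
  have hc : 0 < lam * beta := mul_pos hlam hbeta
  generalize lam * beta = c at hc ⊢
  have young : 0 ≤ (1 + θ) * c ^ 2 * ‖g‖ ^ 2 + 2 * c * ⟪g, x' - x⟫
      + 1 / (1 + θ) * ‖x' - x‖ ^ 2 := by
    have h := sq_nonneg ‖((1 + θ) * c) • g + (x' - x)‖
    rw [norm_add_sq_real, norm_smul, inner_smul_left, Real.norm_eq_abs, mul_pow, sq_abs] at h
    simp only [conj_trivial] at h
    have h' := mul_nonneg (by positivity : 0 ≤ 1 / (1 + θ)) h
    have e : 1 / (1 + θ) * (((1 + θ) * c) ^ 2 * ‖g‖ ^ 2 + 2 * ((1 + θ) * c * ⟪g, x' - x⟫)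
        + ‖x' - x‖ ^ 2) = (1 + θ) * c ^ 2 * ‖g‖ ^ 2 + 2 * c * ⟪g, x' - x⟫
      + 1 / (1 + θ) * ‖x' - x‖ ^ 2 := by field_simp
    rwa [e] at h'
  have A : (2 * L⁻¹ - (1 + θ) * c) * c * ‖g‖ ^ 2 - 1 / (1 + θ) * ‖x' - x‖ ^ 2
      ≤ 2 * c * ⟪g, x' - u⟫ := by
    have := mul_le_mul_of_nonneg_left coco hc.le
    rw [eu]
    linarith
  have B : 2 * c * Ψ₁ x' - L * c * ‖x' - x‖ ^ 2 ≤ 2 * c * ⟪g, x' - u⟫ := by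
    have : Ψ₁ x' - L / 2 * ‖x' - x‖ ^ 2 ≤ ⟪g, x' - u⟫ := by rw [eu]; linarith
    have := mul_le_mul_of_nonneg_left this hc.le
    linarith
  have A' := mul_le_mul_of_nonneg_left A (by positivity : 0 ≤ 1 / (1 + η))
  have B' := mul_le_mul_of_nonneg_left B (by positivity : 0 ≤ η / (1 + η))
  have e1 : 1 / (1 + η) * (2 * c * ⟪g, x' - u⟫) + η / (1 + η) * (2 * c * ⟪g, x' - u⟫)
      = 2 * c * ⟪g, x' - u⟫ := by field_simp
  have e2 : (2 / ((1 + η) * L) - (1 + θ) / (1 + η) * c) * c * ‖g‖ ^ 2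
        + 2 * η / (1 + η) * c * Ψ₁ x'
        - (1 / ((1 + θ) * (1 + η)) + η * L / (1 + η) * c) * ‖x' - x‖ ^ 2
      = 1 / (1 + η) * ((2 * L⁻¹ - (1 + θ) * c) * c * ‖g‖ ^ 2 - 1 / (1 + θ) * ‖x' - x‖ ^ 2)
        + η / (1 + η) * (2 * c * Ψ₁ x' - L * c * ‖x' - x‖ ^ 2) := by
    field_simp
    ring
  rw [e2]
  linarith
end
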